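/- Let Λ be a graded affine k-algebra with associated filtration {Λ_i}, let g = {g_1,…,g_t} be a complete intersection for Λ consisting of homogeneous elements with d_i = deg g_i, let μ_1,…,μ_t ∈ Λ with deg μ_i < deg g_i for all i, and let I_μ = (g_1−μ_1,…,g_t−μ_t). Then: (1) I_μ ∩ Λ_m = Σ_{i=1}^t Λ_{m−d_i}(g_i−μ_i) for every m; (2) the sequence g_1−μ_1,…,g_t−μ_t is a complete intersection for Λ, and moreover a regular sequence; (3) the associated graded ideal of I_μ is the ideal generated by g_1,…,g_t, and in particular I_μ ≠ Λ. -/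

import Mathlib

open scoped TensorProduct

noncomputable section

universe u v w

/-- A sequence `g 0, …, g (t-1)` in a commutative ring is *regular* if for each `i`
the class of `g i` in the quotient by the ideal generated by the previous elements
is neither a zero divisor nor invertible. -/
def IsRegularSequence {Λ : Type u} [CommRing Λ] {t : ℕ} (g : Fin t → Λ) : Prop :=
  ∀ i : Fin t,
    ((∀ x : Λ, g i * x ∈ Ideal.span (g '' {j | j < i}) → x ∈ Ideal.span (g '' {j | j < i})) ∧
      Ideal.span (g '' {j | j ≤ i}) ≠ ⊤)

/-- The `i`-th differential of the Koszul complex of a sequence `g` of elements in a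
`k`-algebra `U`, where the `i`-th term of the complex is the free `U`-module on the
`i`-element subsets of `Fin t` (a model of `U ⊗ Λ^i k^t`), with
`d (u ⊗ e_{j₁} ∧ … ∧ e_{jᵢ}) = Σ (-1)^(m-1) (u * g jₘ) ⊗ e_{j₁} ∧ … ∧ ê_{jₘ} ∧ … ∧ e_{jᵢ}`. -/
noncomputable def koszulD (k : Type u) {U : Type v} [CommRing k] [Ring U] [Algebra k U]
    {t : ℕ} (g : Fin t → U) (i : ℕ) :
    ({s : Finset (Fin t) // s.card = i + 1} →₀ U) →ₗ[k] ({s : Finset (Fin t) // s.card = i} →₀ U) :=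
  Finsupp.lsum k fun s =>
    ∑ j ∈ s.1.attach,
      (Finsupp.lsingle (R := k)
          (⟨s.1.erase j.1, by simp [Finset.card_erase_of_mem j.2, s.2]⟩ :
            {s : Finset (Fin t) // s.card = i})).comp
        (LinearMap.mulRight k (((-1 : U) ^ (s.1.filter fun a => a < j.1).card) * g j.1))

/-- A sequence `g` of (mutually commuting) elements of a `k`-algebra `U` is a
*complete intersection for `U`* if the Koszul homology `H_i(g, U)` vanishes for `i ≠ 0`
and `H_0(g, U) = U/(U g 0 + … + U g (t-1)) ≠ 0`. -/
def IsCompleteIntersection (k : Type u) {U : Type v} [CommRing k] [Ring U] [Algebra k U]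
    {t : ℕ} (g : Fin t → U) : Prop :=
  (∀ i : ℕ, LinearMap.ker (koszulD k g i) = LinearMap.range (koszulD k g (i + 1))) ∧
    Submodule.span U (Set.range g) ≠ ⊤

/-- The `m`-th term `Λ_m = ⊕_{j ≤ m} Λ_(j)` of the filtration associated with a grading. -/
noncomputable def gradedFilt {k : Type u} {Λ : Type v} [CommRing k] [CommRing Λ] [Algebra k Λ]
    (𝒜 : ℕ → Submodule k Λ) (m : ℕ) : Submodule k Λ :=
  ⨆ j, ⨆ (_ : j ≤ m), 𝒜 j

/-- The associated graded ideal of an ideal `I` in a graded algebra (identified with its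
own associated graded algebra): the span of the top-degree homogeneous components of the
elements of `I`. -/
noncomputable def gradedGrIdeal {k : Type u} {Λ : Type v} [Field k] [CommRing Λ] [Algebra k Λ]
    (𝒜 : ℕ → Submodule k Λ) [GradedAlgebra 𝒜] (I : Ideal Λ) : Submodule k Λ :=
  Submodule.span k
    {y | ∃ x ∈ I, ∃ m : ℕ, x ∈ gradedFilt 𝒜 m ∧
      y = ((DirectSum.decompose 𝒜 x m : 𝒜 m) : Λ)}

/-- The homogeneous component of integer degree, zero in negative degrees. -/
def intProj {k : Type u} {Λ : Type v} [Field k] [CommRing Λ] [Algebra k Λ]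
    (𝒜 : ℕ → Submodule k Λ) [GradedAlgebra 𝒜] (n : ℤ) : Λ →ₗ[k] Λ :=
  if 0 ≤ n then GradedAlgebra.proj 𝒜 n.toNat else 0

/-- A family of endomorphisms `Q n` behaving like the projections onto the components of
a nonnegatively graded module. -/
structure IsComponents {k : Type u} {A : Type v} [Field k] [AddCommGroup A] [Module k A]
    (Q : ℤ → A →ₗ[k] A) : Prop where
  neg : ∀ n < 0, ∀ z, Q n z = 0
  bdd : ∀ z, ∃ N : ℤ, ∀ n > N, Q n z = 0
  sep : ∀ z, (∀ n, Q n z = 0) → z = 0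
  same : ∀ n z, Q n (Q n z) = Q n z
  orth : ∀ n m z, n ≠ m → Q n (Q m z) = 0

/-- The degree `n` component on a free module whose basis vectors `e i` have degree `wt i`. -/
def wtProj {k : Type u} {Λ : Type v} [Field k] [AddCommGroup Λ] [Module k Λ]
    (P : ℤ → Λ →ₗ[k] Λ) {ι : Type w} (wt : ι → ℕ) (n : ℤ) : (ι → Λ) →ₗ[k] (ι → Λ) :=
  LinearMap.pi fun i => (P (n - wt i)).comp (LinearMap.proj i)

section Components

variable {k : Type u} [Field k]

@[simp]
theorem wtProj_apply {Λ : Type v} [AddCommGroup Λ] [Module k Λ]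
    (P : ℤ → Λ →ₗ[k] Λ) {ι : Type w} (wt : ι → ℕ) (n : ℤ) (z : ι → Λ) (i : ι) :
    wtProj P wt n z i = P (n - wt i) (z i) := rfl

theorem IsComponents.wtProj {Λ : Type v} [AddCommGroup Λ] [Module k Λ]
    {P : ℤ → Λ →ₗ[k] Λ} (hP : IsComponents P) {ι : Type w} [Finite ι] (wt : ι → ℕ) :
    IsComponents (wtProj P wt) where
  neg n hn z := by
    ext i
    exact hP.neg _ (by omega) _
  bdd z := by
    choose N hN using fun i => hP.bdd (z i)
    obtain ⟨M, hM⟩ := (Set.finite_range fun i => N i + wt i).bddAbove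
    refine ⟨M, fun n hn => ?_⟩
    ext i
    have : N i + wt i ≤ M := hM ⟨i, rfl⟩
    exact hN i _ (by omega)
  sep z hz := by
    ext i
    refine hP.sep _ fun n => ?_
    simpa using congrFun (hz (n + wt i)) i
  same n z := by
    ext i
    exact hP.same _ _
  orth n m z h := by
    ext i
    exact hP.orth _ _ _ (by omega)

theorem IsComponents.exists_eq_sum {A : Type v} [AddCommGroup A] [Module k A]
    {Q : ℤ → A →ₗ[k] A} (hQ : IsComponents Q) (z : A) :
    ∃ N : ℕ, z = ∑ n ∈ Finset.range N, Q n z := by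
  obtain ⟨N, hN⟩ : ∃ N : ℕ, ∀ n > (N : ℤ), Q n z = 0 := by
    obtain ⟨N, hN⟩ := hQ.bdd z
    exact ⟨N.toNat, fun n hn => hN n (by omega)⟩
  refine ⟨N + 1, sub_eq_zero.1 (hQ.sep _ fun n => ?_)⟩
  rw [map_sub, map_sum, sub_eq_zero]
  by_cases h0 : n < 0
  · simp [hQ.neg n h0]
  by_cases hn : N < n
  · rw [hN n hn, Finset.sum_eq_zero]
    intro j hj
    rw [hQ.orth]
    rw [Finset.mem_range] at hj
    omega
  · rw [Finset.sum_eq_single n.toNat]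
    · rw [Int.toNat_of_nonneg (by omega), hQ.same]
    · intro j _ hj
      exact hQ.orth _ _ _ (by omega)
    · intro h
      simp only [Finset.mem_range] at h
      omega

/-- If `ε' ∘ δ' = 0` is a perturbation by terms of lower degree of a graded complex which is
exact in the middle, then every `z` can be moved by a boundary into the smallest filtered
piece allowed by the degree of `ε' z`. -/
theorem IsComponents.exists_sub_mem_filtration
    {A B C : Type*} [AddCommGroup A] [Module k A] [AddCommGroup B] [Module k B]
    [AddCommGroup C] [Module k C] {QA : ℤ → A →ₗ[k] A} {QB : ℤ → B →ₗ[k] B}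
    {QC : ℤ → C →ₗ[k] C} (hA : IsComponents QA) (hB : IsComponents QB)
    (δ δ' : A →ₗ[k] B) (ε ε' : B →ₗ[k] C)
    (hδ : ∀ n z, QB n (δ z) = δ (QA n z)) (hε : ∀ n z, QC n (ε z) = ε (QB n z))
    (hδ' : ∀ m z, (∀ n > m, QA n z = 0) → ∀ n ≥ m, QB n (δ' z) = QB n (δ z))
    (hε' : ∀ m z, (∀ n > m, QB n z = 0) → ∀ n ≥ m, QC n (ε' z) = QC n (ε z))
    (hcomp : ∀ w, ε' (δ' w) = 0) (hex : ∀ z, ε z = 0 → ∃ w, δ w = z)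
    (m : ℤ) (z : B) (hz : ∀ n > m, QC n (ε' z) = 0) :
    ∃ w, ∀ n > m, QB n (z - δ' w) = 0 := by
  have key : ∀ j : ℕ, ∀ z : B, (∀ n > m, QC n (ε' z) = 0) → (∀ n > m + j, QB n z = 0) →
      ∃ w, ∀ n > m, QB n (z - δ' w) = 0 := by
    intro j
    induction j with
    | zero => exact fun z _ h => ⟨0, by simpa using h⟩
    | succ j ih =>
      intro z hz hj
      set N : ℤ := m + (j + 1 : ℕ) with hN
      have h1 : ε (QB N z) = 0 := by
        rw [← hε, ← hε' N z hj N le_rfl, hz N (by omega)]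
      obtain ⟨w₀, hw₀⟩ := hex _ h1
      set w₁ := QA N w₀ with hw₁
      have h2 : δ w₁ = QB N z := by rw [hw₁, ← hδ, hw₀, hB.same]
      have h3 : ∀ n ≥ N, QB n (δ' w₁) = QB n (δ w₁) :=
        hδ' N w₁ fun n hn => hA.orth _ _ _ (by omega)
      obtain ⟨w₂, hw₂⟩ := ih (z - δ' w₁) (by simpa [hcomp] using hz) (by
        intro n hn
        rw [map_sub, h3 n (by omega), h2]
        rcases eq_or_ne n N with rfl | hne
        · rw [hB.same, sub_self]
        · rw [hB.orth _ _ _ hne, hj n (by omega), sub_zero])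
      exact ⟨w₁ + w₂, by simpa [sub_sub] using hw₂⟩
  obtain ⟨N, hN⟩ := hB.bdd z
  exact key (N - m).toNat z hz fun n hn => hN n (by omega)

theorem IsComponents.exact_of_perturbation
    {A B C : Type*} [AddCommGroup A] [Module k A] [AddCommGroup B] [Module k B]
    [AddCommGroup C] [Module k C] {QA : ℤ → A →ₗ[k] A} {QB : ℤ → B →ₗ[k] B}
    {QC : ℤ → C →ₗ[k] C} (hA : IsComponents QA) (hB : IsComponents QB)
    (δ δ' : A →ₗ[k] B) (ε ε' : B →ₗ[k] C)
    (hδ : ∀ n z, QB n (δ z) = δ (QA n z)) (hε : ∀ n z, QC n (ε z) = ε (QB n z))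
    (hδ' : ∀ m z, (∀ n > m, QA n z = 0) → ∀ n ≥ m, QB n (δ' z) = QB n (δ z))
    (hε' : ∀ m z, (∀ n > m, QB n z = 0) → ∀ n ≥ m, QC n (ε' z) = QC n (ε z))
    (hcomp : ∀ w, ε' (δ' w) = 0) (hex : ∀ z, ε z = 0 → ∃ w, δ w = z)
    (z : B) (hz : ε' z = 0) : ∃ w, δ' w = z := by
  obtain ⟨w, hw⟩ := hA.exists_sub_mem_filtration hB δ δ' ε ε' hδ hε hδ' hε' hcomp hex (-1) z
    (by simp [hz])
  refine ⟨w, (sub_eq_zero.1 (hB.sep _ fun n => ?_)).symm⟩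
  by_cases hn : n < 0
  · exact hB.neg n hn _
  · exact hw n (by omega)

end Components

section IntProj

variable {k : Type u} {Λ : Type v} [Field k] [CommRing Λ] [Algebra k Λ]
  (𝒜 : ℕ → Submodule k Λ) [GradedAlgebra 𝒜]

theorem intProj_natCast (n : ℕ) (x : Λ) :
    intProj 𝒜 n x = (DirectSum.decompose 𝒜 x n : 𝒜 n) := by
  simp [intProj, GradedAlgebra.proj_apply]

theorem intProj_of_neg {n : ℤ} (hn : n < 0) (x : Λ) : intProj 𝒜 n x = 0 := by
  simp [intProj, hn.not_ge]

theorem intProj_of_mem {n : ℤ} {j : ℕ} {x : Λ} (hx : x ∈ 𝒜 j) :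
    intProj 𝒜 n x = if n = j then x else 0 := by
  rcases lt_or_ge n 0 with hn | hn
  · rw [intProj_of_neg 𝒜 hn, if_neg (by omega)]
  · lift n to ℕ using hn
    rw [intProj_natCast]
    split_ifs with h
    · obtain rfl : n = j := by exact_mod_cast h
      exact DirectSum.decompose_of_mem_same 𝒜 hx
    · exact DirectSum.decompose_of_mem_ne 𝒜 hx (by omega)

theorem isComponents_intProj : IsComponents (intProj 𝒜) where
  neg n hn z := intProj_of_neg 𝒜 hn z
  bdd z := by
    classical
    obtain ⟨M, hM⟩ := (DirectSum.decompose 𝒜 z).support.bddAbove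
    refine ⟨M, fun n hn => ?_⟩
    lift n to ℕ using by omega
    rw [intProj_natCast]
    by_contra h
    have := hM (DFinsupp.mem_support_iff.2 fun h' => h (by rw [h']; rfl))
    omega
  sep z hz := by
    apply (DirectSum.decompose 𝒜).injective
    ext n
    simpa [intProj_natCast] using hz n
  same n z := by
    rcases lt_or_ge n 0 with hn | hn
    · simp [intProj_of_neg 𝒜 hn]
    · lift n to ℕ using hn
      rw [intProj_of_mem 𝒜 (j := n) (by rw [intProj_natCast]; exact SetLike.coe_mem _), if_pos rfl]
  orth n m z h := by
    rcases lt_or_ge m 0 with hm | hm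
    · simp [intProj_of_neg 𝒜 hm]
    · lift m to ℕ using hm
      rw [intProj_of_mem 𝒜 (j := m) (by rw [intProj_natCast]; exact SetLike.coe_mem _), if_neg h]

theorem intProj_mul_of_mem {d : ℕ} {x : Λ} (hx : x ∈ 𝒜 d) (n : ℤ) (a : Λ) :
    intProj 𝒜 n (a * x) = intProj 𝒜 (n - d) a * x := by
  rcases lt_or_ge n 0 with hn | hn
  · rw [intProj_of_neg 𝒜 hn, intProj_of_neg 𝒜 (by omega), zero_mul]
  lift n to ℕ using hn
  rw [intProj_natCast]
  rcases lt_or_ge n d with h | h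
  · rw [DirectSum.coe_decompose_mul_of_right_mem_of_not_le 𝒜 hx (by omega),
      intProj_of_neg 𝒜 (by omega), zero_mul]
  · rw [DirectSum.coe_decompose_mul_of_right_mem_of_le 𝒜 hx h, ← Nat.cast_sub h,
      intProj_natCast]

theorem intProj_mul_of_mem_iSup_lt {d : ℕ} {x : Λ} (hx : x ∈ ⨆ j, ⨆ (_ : j < d), 𝒜 j)
    {m : ℤ} {a : Λ} (ha : ∀ n > m, intProj 𝒜 n a = 0) {n : ℤ} (hn : m + d ≤ n) :
    intProj 𝒜 n (a * x) = 0 := by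
  suffices (⨆ j, ⨆ (_ : j < d), 𝒜 j) ≤
      LinearMap.ker ((intProj 𝒜 n).comp (LinearMap.mulLeft k a)) from this hx
  refine iSup₂_le fun j hj y hy => ?_
  simp [intProj_mul_of_mem 𝒜 hy, ha (n - j) (by omega)]

theorem intProj_mul_sub {d : ℕ} {μ : Λ} (g : Λ) (hμ : μ ∈ ⨆ j, ⨆ (_ : j < d), 𝒜 j)
    {m : ℤ} {a : Λ} (ha : ∀ n > m, intProj 𝒜 n a = 0) {n : ℤ} (hn : m + d ≤ n) :
    intProj 𝒜 n (a * (g - μ)) = intProj 𝒜 n (a * g) := by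
  rw [mul_sub, map_sub, intProj_mul_of_mem_iSup_lt 𝒜 hμ ha hn, sub_zero]

theorem mem_gradedFilt_iff {m : ℕ} {x : Λ} :
    x ∈ gradedFilt 𝒜 m ↔ ∀ n > (m : ℤ), intProj 𝒜 n x = 0 := by
  constructor
  · intro hx n hn
    suffices gradedFilt 𝒜 m ≤ LinearMap.ker (intProj 𝒜 n) from this hx
    refine iSup₂_le fun j hj y hy => ?_
    rw [LinearMap.mem_ker, intProj_of_mem 𝒜 hy, if_neg (by omega)]
  · intro h
    obtain ⟨N, hN⟩ := (isComponents_intProj 𝒜).exists_eq_sum x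
    rw [hN]
    refine Submodule.sum_mem _ fun n _ => ?_
    by_cases hn : n ≤ m
    · refine Submodule.mem_iSup_of_mem n (Submodule.mem_iSup_of_mem hn ?_)
      rw [intProj_natCast]
      exact SetLike.coe_mem _
    · rw [h n (by omega)]
      exact zero_mem _

end IntProj

/-- The map `a ↦ ∑ i, a i * g i`. -/
def relMap (k : Type u) {Λ : Type v} [Field k] [CommRing Λ] [Algebra k Λ] {t : ℕ}
    (g : Fin t → Λ) : (Fin t → Λ) →ₗ[k] Λ :=
  ∑ i, (LinearMap.mulRight k (g i)).comp (LinearMap.proj i)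

/-- The map sending a matrix `u` to the combination of trivial relations between the `g i`
given by its antisymmetrization. -/
def trivialRelMap (k : Type u) {Λ : Type v} [Field k] [CommRing Λ] [Algebra k Λ] {t : ℕ}
    (g : Fin t → Λ) : (Fin t × Fin t → Λ) →ₗ[k] (Fin t → Λ) :=
  LinearMap.pi fun i => ∑ j, (LinearMap.mulRight k (g j)).comp
    (LinearMap.proj (R := k) (φ := fun _ => Λ) (i, j) - LinearMap.proj (R := k) (φ := fun _ => Λ) (j, i))

/-- All relations between the members of `g` are combinations of the trivial ones. -/
def RelationsTrivial (k : Type u) {Λ : Type v} [Field k] [CommRing Λ] [Algebra k Λ] {t : ℕ}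
    (g : Fin t → Λ) : Prop :=
  ∀ a, relMap k g a = 0 → ∃ u, trivialRelMap k g u = a

section Relations

variable {k : Type u} {Λ : Type v} [Field k] [CommRing Λ] [Algebra k Λ] {t : ℕ}

theorem relMap_apply (g : Fin t → Λ) (a : Fin t → Λ) : relMap k g a = ∑ i, a i * g i := by
  simp [relMap]

theorem trivialRelMap_apply (g : Fin t → Λ) (u : Fin t × Fin t → Λ) (i : Fin t) :
    trivialRelMap k g u i = ∑ j, (u (i, j) - u (j, i)) * g j := by
  simp [trivialRelMap]

theorem relMap_trivialRelMap (g : Fin t → Λ) (u : Fin t × Fin t → Λ) :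
    relMap k g (trivialRelMap k g u) = 0 := by
  simp only [relMap_apply, trivialRelMap_apply, Finset.sum_mul, sub_mul, Finset.sum_sub_distrib]
  rw [sub_eq_zero, Finset.sum_comm]
  exact Finset.sum_congr rfl fun i _ => Finset.sum_congr rfl fun j _ => by ring

theorem mem_span_range_iff_relMap (g : Fin t → Λ) (x : Λ) :
    x ∈ Ideal.span (Set.range g) ↔ ∃ a, relMap k g a = x := by
  simp only [Ideal.mem_span_range_iff_exists_fun, relMap_apply]

variable (𝒜 : ℕ → Submodule k Λ) [GradedAlgebra 𝒜]

theorem intProj_relMap {g : Fin t → Λ} {d : Fin t → ℕ} (hg : ∀ i, g i ∈ 𝒜 (d i))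
    (n : ℤ) (a : Fin t → Λ) :
    intProj 𝒜 n (relMap k g a) = relMap k g (wtProj (intProj 𝒜) d n a) := by
  simp [relMap_apply, intProj_mul_of_mem 𝒜 (hg _)]

theorem intProj_trivialRelMap {g : Fin t → Λ} {d : Fin t → ℕ} (hg : ∀ i, g i ∈ 𝒜 (d i))
    (n : ℤ) (u : Fin t × Fin t → Λ) :
    wtProj (intProj 𝒜) d n (trivialRelMap k g u) =
      trivialRelMap k g (wtProj (intProj 𝒜) (fun p => d p.1 + d p.2) n u) := by
  ext i
  simp only [wtProj_apply, trivialRelMap_apply, map_sum, intProj_mul_of_mem 𝒜 (hg _), map_sub]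
  refine Finset.sum_congr rfl fun j _ => ?_
  push_cast
  rw [sub_sub, add_comm (d j : ℤ) (d i : ℤ)]

theorem intProj_relMap_sub (g : Fin t → Λ) {μ : Fin t → Λ} {d : Fin t → ℕ}
    (hμ : ∀ i, μ i ∈ ⨆ j, ⨆ (_ : j < d i), 𝒜 j) (m : ℤ) (a : Fin t → Λ)
    (ha : ∀ n > m, wtProj (intProj 𝒜) d n a = 0) (n : ℤ) (hn : n ≥ m) :
    intProj 𝒜 n (relMap k (fun i => g i - μ i) a) = intProj 𝒜 n (relMap k g a) := by
  simp only [relMap_apply, map_sum]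
  refine Finset.sum_congr rfl fun i _ => ?_
  refine intProj_mul_sub 𝒜 _ (hμ i) (m := m - d i) (fun n hn => ?_) (by omega)
  simpa using congrFun (ha (n + d i) (by omega)) i

theorem intProj_trivialRelMap_sub (g : Fin t → Λ) {μ : Fin t → Λ} {d : Fin t → ℕ}
    (hμ : ∀ i, μ i ∈ ⨆ j, ⨆ (_ : j < d i), 𝒜 j) (m : ℤ) (u : Fin t × Fin t → Λ)
    (hu : ∀ n > m, wtProj (intProj 𝒜) (fun p => d p.1 + d p.2) n u = 0) (n : ℤ) (hn : n ≥ m) :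
    wtProj (intProj 𝒜) d n (trivialRelMap k (fun i => g i - μ i) u) =
      wtProj (intProj 𝒜) d n (trivialRelMap k g u) := by
  have key : ∀ p : Fin t × Fin t, ∀ n > m - d p.1 - d p.2, intProj 𝒜 n (u p) = 0 := by
    intro p n hn
    have := congrFun (hu (n + (d p.1 + d p.2 : ℕ)) (by push_cast; omega)) p
    rwa [wtProj_apply, add_sub_cancel_right] at this
  ext i
  simp only [wtProj_apply, trivialRelMap_apply, map_sum]
  refine Finset.sum_congr rfl fun j _ => ?_
  refine intProj_mul_sub 𝒜 _ (hμ j) (m := m - d i - d j) (fun n hn => ?_) (by omega)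
  rw [map_sub, key (i, j) n hn, key (j, i) n (by simp only; omega), sub_zero]

theorem RelationsTrivial.exists_relMap_eq {g : Fin t → Λ} (h : RelationsTrivial k g)
    {μ : Fin t → Λ} {d : Fin t → ℕ} (hg : ∀ i, g i ∈ 𝒜 (d i))
    (hμ : ∀ i, μ i ∈ ⨆ j, ⨆ (_ : j < d i), 𝒜 j) (m : ℤ) {x : Λ}
    (hx : x ∈ Ideal.span (Set.range fun i => g i - μ i)) (hm : ∀ n > m, intProj 𝒜 n x = 0) :
    ∃ a, relMap k (fun i => g i - μ i) a = x ∧ ∀ n > m, wtProj (intProj 𝒜) d n a = 0 := by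
  obtain ⟨a, rfl⟩ := (mem_span_range_iff_relMap (k := k) _ _).1 hx
  have hc := isComponents_intProj 𝒜
  obtain ⟨w, hw⟩ := (hc.wtProj fun p : Fin t × Fin t => d p.1 + d p.2).exists_sub_mem_filtration
    (hc.wtProj d) (trivialRelMap k g) (trivialRelMap k fun i => g i - μ i) (relMap k g)
    (relMap k fun i => g i - μ i) (intProj_trivialRelMap 𝒜 hg) (intProj_relMap 𝒜 hg)
    (intProj_trivialRelMap_sub 𝒜 g hμ) (intProj_relMap_sub 𝒜 g hμ) (relMap_trivialRelMap _) h
    m a hm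
  exact ⟨_, by rw [map_sub, relMap_trivialRelMap, sub_zero], hw⟩

theorem RelationsTrivial.sub {g : Fin t → Λ} (h : RelationsTrivial k g)
    {μ : Fin t → Λ} {d : Fin t → ℕ} (hg : ∀ i, g i ∈ 𝒜 (d i))
    (hμ : ∀ i, μ i ∈ ⨆ j, ⨆ (_ : j < d i), 𝒜 j) :
    RelationsTrivial k fun i => g i - μ i := by
  have hc := isComponents_intProj 𝒜
  exact (hc.wtProj fun p : Fin t × Fin t => d p.1 + d p.2).exact_of_perturbation
    (hc.wtProj d) (trivialRelMap k g) (trivialRelMap k fun i => g i - μ i) (relMap k g)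
    (relMap k fun i => g i - μ i) (intProj_trivialRelMap 𝒜 hg) (intProj_relMap 𝒜 hg)
    (intProj_trivialRelMap_sub 𝒜 g hμ) (intProj_relMap_sub 𝒜 g hμ) (relMap_trivialRelMap _) h

theorem RelationsTrivial.castSucc {g : Fin (t + 1) → Λ} (h : RelationsTrivial k g)
    {d : Fin (t + 1) → ℕ} (hg : ∀ i, g i ∈ 𝒜 (d i)) (hd : 0 < d (Fin.last t)) :
    RelationsTrivial k fun i : Fin t => g i.castSucc := by
  have hc := isComponents_intProj 𝒜
  set g' : Fin t → Λ := fun i => g i.castSucc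
  set d' : Fin t → ℕ := fun i => d i.castSucc
  have hg' : ∀ i, g' i ∈ 𝒜 (d' i) := fun i => hg _
  have step : ∀ a, relMap k g' a = 0 → ∃ u b, relMap k g' b = 0 ∧
      a = trivialRelMap k g' u + fun i => b i * g (Fin.last t) := by
    intro a ha
    obtain ⟨u, hu⟩ := h (Fin.snoc a 0) (by
      rw [relMap_apply] at ha ⊢
      simpa [Fin.sum_univ_castSucc] using ha)
    refine ⟨fun p => u (p.1.castSucc, p.2.castSucc),
      fun i => u (i.castSucc, Fin.last t) - u (Fin.last t, i.castSucc), ?_, ?_⟩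
    · have := congrFun hu (Fin.last t)
      rw [trivialRelMap_apply, Fin.sum_univ_castSucc, Fin.snoc_last, sub_self, zero_mul,
        add_zero] at this
      rw [relMap_apply, ← neg_eq_zero, ← this, ← Finset.sum_neg_distrib]
      exact Finset.sum_congr rfl fun i _ => by ring
    · ext i
      have := congrFun hu i.castSucc
      rw [trivialRelMap_apply, Fin.sum_univ_castSucc, Fin.snoc_castSucc] at this
      rw [← this, Pi.add_apply, trivialRelMap_apply]
  have key : ∀ m : ℕ, ∀ a, relMap k g' a = 0 →
      ∃ u, trivialRelMap k g' u = wtProj (intProj 𝒜) d' m a := by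
    intro m
    induction m using Nat.strong_induction_on with
    | _ m ih =>
      intro a ha
      obtain ⟨u, b, hb, hab⟩ := step a ha
      obtain ⟨v, hv⟩ : ∃ v, trivialRelMap k g' v =
          wtProj (intProj 𝒜) d' (m - d (Fin.last t)) b := by
        by_cases hm : d (Fin.last t) ≤ m
        · rw [← Nat.cast_sub hm]
          exact ih _ (by omega) b hb
        · exact ⟨0, by rw [map_zero, (hc.wtProj d').neg _ (by omega)]⟩
      refine ⟨wtProj (intProj 𝒜) (fun p => d' p.1 + d' p.2) m u +
        fun p => v p * g (Fin.last t), ?_⟩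
      rw [hab, map_add, map_add, intProj_trivialRelMap 𝒜 hg']
      congr 1
      ext i
      rw [wtProj_apply, intProj_mul_of_mem 𝒜 (hg _), sub_right_comm]
      have := congrFun hv i
      rw [wtProj_apply] at this
      rw [← this, trivialRelMap_apply, trivialRelMap_apply, Finset.sum_mul]
      exact Finset.sum_congr rfl fun j _ => by ring
  intro a ha
  obtain ⟨N, hN⟩ := (hc.wtProj d').exists_eq_sum a
  choose u hu using fun m => key m a ha
  exact ⟨∑ n ∈ Finset.range N, u n, by rw [map_sum, hN]; simp only [hu, ← hN]⟩

theorem RelationsTrivial.castLE {g : Fin t → Λ} (h : RelationsTrivial k g)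
    {d : Fin t → ℕ} (hg : ∀ i, g i ∈ 𝒜 (d i)) (hd : ∀ i, 0 < d i) {s : ℕ} (hs : s ≤ t) :
    RelationsTrivial k fun i : Fin s => g (i.castLE hs) := by
  induction hs using Nat.decreasingInduction with
  | self => exact h
  | of_succ s hs ih => exact ih.castSucc 𝒜 (d := fun i => d (i.castLE hs)) (fun i => hg _) (hd _)

theorem RelationsTrivial.mem_of_last_mul_mem {g : Fin (t + 1) → Λ} (h : RelationsTrivial k g)
    {x : Λ} (hx : g (Fin.last t) * x ∈ Ideal.span (Set.range fun i : Fin t => g i.castSucc)) :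
    x ∈ Ideal.span (Set.range fun i : Fin t => g i.castSucc) := by
  obtain ⟨a, ha⟩ := (mem_span_range_iff_relMap (k := k) _ _).1 hx
  obtain ⟨u, hu⟩ := h (Fin.snoc a (-x)) (by
    rw [relMap_apply] at ha ⊢
    simp [Fin.sum_univ_castSucc, ha, mul_comm])
  have := congrFun hu (Fin.last t)
  rw [trivialRelMap_apply, Fin.sum_univ_castSucc, Fin.snoc_last, sub_self, zero_mul,
    add_zero] at this
  rw [← neg_mem_iff, ← this]
  exact Submodule.sum_mem _ fun i _ => Ideal.mul_mem_left _ _ (Ideal.subset_span ⟨i, rfl⟩)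

end Relations

/-- Extension by zero of a Koszul chain to all subsets of `Fin t`. -/
def koszulExtend (k : Type u) {Λ : Type v} [Field k] [CommRing Λ] [Algebra k Λ] (t i : ℕ) :
    ({s : Finset (Fin t) // s.card = i} →₀ Λ) →ₗ[k] (Finset (Fin t) → Λ) :=
  LinearMap.pi fun s => if h : s.card = i then Finsupp.lapply ⟨s, h⟩ else 0

/-- The Koszul differential on the direct sum of all terms of the complex, in coordinates. -/
def koszulTotal {Λ : Type v} [CommRing Λ] {t : ℕ} (g : Fin t → Λ) (z : Finset (Fin t) → Λ)
    (T : Finset (Fin t)) : Λ :=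
  ∑ j ∈ Tᶜ, (-1 : ℤ) ^ (T.filter (· < j)).card • (z (insert j T) * g j)

/-- The degree components on the terms of the Koszul complex of a sequence of elements of
degrees `d i`. -/
def koszulProj {k : Type u} {Λ : Type v} [Field k] [CommRing Λ] [Algebra k Λ]
    (P : ℤ → Λ →ₗ[k] Λ) {t : ℕ} (d : Fin t → ℕ) (i : ℕ) (n : ℤ) :
    ({s : Finset (Fin t) // s.card = i} →₀ Λ) →ₗ[k] ({s : Finset (Fin t) // s.card = i} →₀ Λ) :=
  (Finsupp.linearEquivFunOnFinite k Λ _).symm.conj (wtProj P (fun s => ∑ j ∈ s.1, d j) n)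

section Koszul

variable {k : Type u} {Λ : Type v} [Field k] [CommRing Λ] [Algebra k Λ] {t : ℕ}

theorem koszulExtend_apply {i : ℕ} (z : {s : Finset (Fin t) // s.card = i} →₀ Λ)
    (s : Finset (Fin t)) :
    koszulExtend k t i z s = if h : s.card = i then z ⟨s, h⟩ else 0 := by
  simp only [koszulExtend, LinearMap.pi_apply]
  split_ifs <;> rfl

theorem koszulExtend_coe {i : ℕ} (z : {s : Finset (Fin t) // s.card = i} →₀ Λ)
    (s : {s : Finset (Fin t) // s.card = i}) : koszulExtend k t i z s.1 = z s := by
  rw [koszulExtend_apply, dif_pos s.2]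

theorem koszulD_apply (g : Fin t → Λ) (i : ℕ) (z : {s : Finset (Fin t) // s.card = i + 1} →₀ Λ)
    (T : {s : Finset (Fin t) // s.card = i}) :
    koszulD k g i z T = koszulTotal g (koszulExtend k t (i + 1) z) T.1 := by
  induction z using Finsupp.induction_linear with
  | zero => simp [koszulTotal]
  | add a b ha hb =>
    simp only [map_add, Finsupp.add_apply, ha, hb, koszulTotal, Pi.add_apply, add_mul, smul_add,
      Finset.sum_add_distrib]
  | single s c =>
    have h1 : koszulD k g i (Finsupp.single s c) T = ∑ j ∈ s.1, if s.1.erase j = T.1 then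
        c * ((-1) ^ (s.1.filter fun a => a < j).card * g j) else 0 := by
      rw [← Finset.sum_attach]
      simp only [koszulD, Finsupp.lsum_single, LinearMap.sum_apply, LinearMap.comp_apply,
        Finsupp.lsingle_apply, LinearMap.mulRight_apply, Finsupp.finsetSum_apply,
        Finsupp.single_apply, Subtype.ext_iff]
    rw [h1, koszulTotal, ← Finset.sum_filter, ← Finset.sum_filter_add_sum_filter_not T.1ᶜ
      (fun j => insert j T.1 = s.1)]
    rw [Finset.sum_eq_zero (s := T.1ᶜ.filter fun j => ¬ insert j T.1 = s.1), add_zero]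
    · refine Finset.sum_congr ?_ fun j hj => ?_
      · ext j
        simp only [Finset.mem_filter, Finset.mem_compl]
        constructor
        · rintro ⟨hj, h⟩
          rw [← h]
          exact ⟨Finset.notMem_erase _ _, Finset.insert_erase hj⟩
        · rintro ⟨hj, h⟩
          rw [← h]
          exact ⟨Finset.mem_insert_self _ _, Finset.erase_insert hj⟩
      · obtain ⟨-, hj⟩ := Finset.mem_filter.1 hj
        rw [hj, koszulExtend_coe, Finsupp.single_eq_same, ← hj, Finset.filter_insert,
          if_neg (lt_irrefl j), zsmul_eq_mul]
        push_cast
        ring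
    · intro j hj
      obtain ⟨-, hj⟩ := Finset.mem_filter.1 hj
      rw [koszulExtend_apply]
      split_ifs with h
      · rw [Finsupp.single_eq_of_ne, zero_mul, smul_zero]
        rintro rfl
        exact hj rfl
      · rw [zero_mul, smul_zero]

theorem koszulExtend_koszulD (g : Fin t → Λ) (i : ℕ)
    (z : {s : Finset (Fin t) // s.card = i + 1} →₀ Λ) :
    koszulExtend k t i (koszulD k g i z) = koszulTotal g (koszulExtend k t (i + 1) z) := by
  ext T
  rw [koszulExtend_apply]
  split_ifs with h
  · exact koszulD_apply g i z ⟨T, h⟩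
  · refine (Finset.sum_eq_zero fun j hj => ?_).symm
    rw [koszulExtend_apply, dif_neg, zero_mul, smul_zero]
    rw [Finset.card_insert_of_notMem (Finset.mem_compl.1 hj)]
    omega

theorem koszulTotal_koszulTotal (g : Fin t → Λ) (z : Finset (Fin t) → Λ)
    (T : Finset (Fin t)) : koszulTotal g (koszulTotal g z) T = 0 := by
  simp only [koszulTotal, Finset.sum_mul, Finset.smul_sum]
  rw [Finset.sum_sigma']
  have sign : ∀ j ∉ T, ∀ l, (((insert j T).filter (· < l)).card) =
      (T.filter (· < l)).card + if j < l then 1 else 0 := by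
    intro j hj l
    rw [Finset.filter_insert]
    split_ifs
    · exact Finset.card_insert_of_notMem fun h => hj (Finset.mem_filter.1 h).1
    · rfl
  refine Finset.sum_involution (fun p _ => ⟨p.2, p.1⟩) ?_ ?_ ?_ ?_
  · rintro ⟨j, l⟩ hp
    simp only [Finset.mem_sigma, Finset.mem_compl, Finset.mem_insert, not_or] at hp
    obtain ⟨hj, hlj, hl⟩ := hp
    simp only [sign j hj, sign l hl, Finset.insert_comm l j T, zsmul_eq_mul, pow_add]
    rcases lt_or_gt_of_ne hlj with h | h
    · simp only [h, h.not_gt, if_true, if_false]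
      push_cast
      ring
    · simp only [h, h.not_gt, if_true, if_false]
      push_cast
      ring
  · rintro ⟨j, l⟩ hp - h
    simp only [Finset.mem_sigma, Finset.mem_compl, Finset.mem_insert, not_or] at hp
    simp only [Sigma.mk.injEq, heq_eq_eq] at h
    exact hp.2.1 h.1
  · rintro ⟨j, l⟩ hp
    simp only [Finset.mem_sigma, Finset.mem_compl, Finset.mem_insert, not_or] at hp ⊢
    exact ⟨hp.2.2, Ne.symm hp.2.1, hp.1⟩
  · rintro ⟨j, l⟩ hp
    rfl

theorem koszulD_koszulD (g : Fin t → Λ) (i : ℕ)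
    (z : {s : Finset (Fin t) // s.card = i + 1 + 1} →₀ Λ) :
    koszulD k g i (koszulD k g (i + 1) z) = 0 := by
  ext T
  rw [koszulD_apply, koszulExtend_koszulD, koszulTotal_koszulTotal, Finsupp.zero_apply]

theorem koszulProj_apply (P : ℤ → Λ →ₗ[k] Λ) (d : Fin t → ℕ) (i : ℕ) (n : ℤ)
    (z : {s : Finset (Fin t) // s.card = i} →₀ Λ) (s : {s : Finset (Fin t) // s.card = i}) :
    koszulProj P d i n z s = P (n - ∑ j ∈ s.1, d j) (z s) := by
  simp [koszulProj, LinearEquiv.conj_apply]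

theorem IsComponents.koszulProj {P : ℤ → Λ →ₗ[k] Λ} (hP : IsComponents P) (d : Fin t → ℕ)
    (i : ℕ) : IsComponents (koszulProj P d i) := by
  have h := hP.wtProj fun s : {s : Finset (Fin t) // s.card = i} => ∑ j ∈ s.1, d j
  have e : ∀ n z, (_root_.koszulProj P d i n z : _ → Λ) = _root_.wtProj P _ n z :=
    fun n z => funext fun s => koszulProj_apply P d i n z s
  constructor
  · exact fun n hn z => DFunLike.coe_injective (by rw [e, h.neg n hn]; rfl)
  · intro z
    obtain ⟨N, hN⟩ := h.bdd z
    exact ⟨N, fun n hn => DFunLike.coe_injective (by rw [e, hN n hn]; rfl)⟩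
  · exact fun z hz => DFunLike.coe_injective (h.sep z fun n => by rw [← e, hz]; rfl)
  · exact fun n z => DFunLike.coe_injective (by rw [e, e, h.same])
  · exact fun n m z hnm => DFunLike.coe_injective (by rw [e, e, h.orth _ _ _ hnm]; rfl)

variable (𝒜 : ℕ → Submodule k Λ) [GradedAlgebra 𝒜]

theorem koszulProj_koszulD {g : Fin t → Λ} {d : Fin t → ℕ} (hg : ∀ i, g i ∈ 𝒜 (d i))
    (i : ℕ) (n : ℤ) (z : {s : Finset (Fin t) // s.card = i + 1} →₀ Λ) :
    koszulProj (intProj 𝒜) d i n (koszulD k g i z) =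
      koszulD k g i (koszulProj (intProj 𝒜) d (i + 1) n z) := by
  ext T
  rw [koszulProj_apply, koszulD_apply, koszulD_apply, koszulTotal, koszulTotal, map_sum]
  refine Finset.sum_congr rfl fun j hj => ?_
  rw [Finset.mem_compl] at hj
  have hc : (insert j T.1).card = i + 1 := by rw [Finset.card_insert_of_notMem hj, T.2]
  rw [map_zsmul, intProj_mul_of_mem 𝒜 (hg j), koszulExtend_apply, koszulExtend_apply, dif_pos hc,
    dif_pos hc, koszulProj_apply, Finset.sum_insert hj]
  push_cast
  rw [sub_sub, add_comm (d j : ℤ)]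

theorem koszulProj_koszulD_sub (g : Fin t → Λ) {μ : Fin t → Λ} {d : Fin t → ℕ}
    (hμ : ∀ i, μ i ∈ ⨆ j, ⨆ (_ : j < d i), 𝒜 j) (i : ℕ) (m : ℤ)
    (z : {s : Finset (Fin t) // s.card = i + 1} →₀ Λ)
    (hz : ∀ n > m, koszulProj (intProj 𝒜) d (i + 1) n z = 0) (n : ℤ) (hn : n ≥ m) :
    koszulProj (intProj 𝒜) d i n (koszulD k (fun i => g i - μ i) i z) =
      koszulProj (intProj 𝒜) d i n (koszulD k g i z) := by
  ext T
  rw [koszulProj_apply, koszulProj_apply, koszulD_apply, koszulD_apply, koszulTotal, koszulTotal,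
    map_sum, map_sum]
  refine Finset.sum_congr rfl fun j hj => ?_
  rw [Finset.mem_compl] at hj
  have hc : (insert j T.1).card = i + 1 := by rw [Finset.card_insert_of_notMem hj, T.2]
  rw [map_zsmul, map_zsmul, koszulExtend_apply, dif_pos hc]
  congr 1
  refine intProj_mul_sub 𝒜 _ (hμ j) (m := m - (∑ l ∈ insert j T.1, d l : ℕ)) (fun n hn => ?_) ?_
  · have := DFunLike.congr_fun (hz (n + (∑ l ∈ insert j T.1, d l : ℕ)) (by omega))
      ⟨_, hc⟩
    rwa [koszulProj_apply, add_sub_cancel_right] at this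
  · rw [Finset.sum_insert hj]
    push_cast
    omega

theorem ker_koszulD_sub_eq_range {g : Fin t → Λ} {d : Fin t → ℕ} (hg : ∀ i, g i ∈ 𝒜 (d i))
    {μ : Fin t → Λ} (hμ : ∀ i, μ i ∈ ⨆ j, ⨆ (_ : j < d i), 𝒜 j) (i : ℕ)
    (h : LinearMap.ker (koszulD k g i) = LinearMap.range (koszulD k g (i + 1))) :
    LinearMap.ker (koszulD k (fun i => g i - μ i) i) =
      LinearMap.range (koszulD k (fun i => g i - μ i) (i + 1)) := by
  have hc := isComponents_intProj 𝒜
  refine le_antisymm (fun z hz => ?_) ?_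
  · exact (hc.koszulProj d (i + 2)).exact_of_perturbation (hc.koszulProj d (i + 1))
      (koszulD k g (i + 1)) (koszulD k (fun i => g i - μ i) (i + 1)) (koszulD k g i)
      (koszulD k (fun i => g i - μ i) i) (koszulProj_koszulD 𝒜 hg _) (koszulProj_koszulD 𝒜 hg _)
      (koszulProj_koszulD_sub 𝒜 g hμ _) (koszulProj_koszulD_sub 𝒜 g hμ _) (koszulD_koszulD _ i)
      (fun z hz => h.le hz) z hz
  · rintro _ ⟨z, rfl⟩
    exact koszulD_koszulD _ i z

theorem relationsTrivial_of_ker_koszulD_eq_range {g : Fin t → Λ}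
    (h : LinearMap.ker (koszulD k g 0) = LinearMap.range (koszulD k g 1)) :
    RelationsTrivial k g := by
  intro a ha
  let z : {s : Finset (Fin t) // s.card = 0 + 1} →₀ Λ :=
    Finsupp.equivFunOnFinite.symm fun s => ∑ j ∈ s.1, a j
  have hz : koszulD k g 0 z = 0 := by
    ext ⟨T, hT⟩
    obtain rfl := Finset.card_eq_zero.1 hT
    rw [relMap_apply] at ha
    rw [koszulD_apply]
    simpa [koszulTotal, koszulExtend_apply, z] using ha
  obtain ⟨w, hw⟩ : z ∈ LinearMap.range (koszulD k g 1) := h.le hz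
  refine ⟨fun p => if p.1 < p.2 then -koszulExtend k t 2 w {p.1, p.2} else 0, ?_⟩
  ext i
  have hi : z ⟨{i}, by simp⟩ = a i := by simp [z]
  rw [← hi, ← hw, koszulD_apply, koszulTotal, trivialRelMap_apply,
    ← Finset.sum_subset (Finset.subset_univ ({i} : Finset (Fin t))ᶜ)]
  · refine Finset.sum_congr rfl fun j hj => ?_
    rw [Finset.mem_compl, Finset.mem_singleton] at hj
    rcases lt_or_gt_of_ne hj with h | h
    · simp [h, h.not_gt, Finset.filter_singleton]
    · simp [h, h.not_gt, Finset.filter_singleton, Finset.pair_comm]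
  · intro j _ hj
    have : j = i := by simpa using hj
    simp [this]

end Koszul

section Main

variable {k : Type u} {Λ : Type v} [Field k] [CommRing Λ] [Algebra k Λ] {t : ℕ}
  (𝒜 : ℕ → Submodule k Λ)

theorem degree_pos_of_isCompleteIntersection (h0 : 𝒜 0 = 1) {g : Fin t → Λ} {d : Fin t → ℕ}
    (hg : ∀ i, g i ∈ 𝒜 (d i)) (hCI : IsCompleteIntersection k g) (i : Fin t) : 0 < d i := by
  by_contra hi
  obtain ⟨c, hc⟩ : ∃ c : k, algebraMap k Λ c = g i := by
    have := hg i
    rwa [Nat.eq_zero_of_not_pos hi, h0, Submodule.mem_one] at this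
  refine hCI.2 ((Ideal.eq_top_iff_one _).2 ?_)
  rcases eq_or_ne c 0 with rfl | hc0
  · rw [map_zero] at hc
    obtain ⟨u, hu⟩ := relationsTrivial_of_ker_koszulD_eq_range (hCI.1 0) (Pi.single i 1) (by
      rw [relMap_apply, Finset.sum_eq_single i] <;> simp +contextual [← hc])
    have := congrFun hu i
    rw [trivialRelMap_apply, Pi.single_eq_same] at this
    rw [← this]
    exact Submodule.sum_mem _ fun j _ => Ideal.mul_mem_left _ _ (Ideal.subset_span ⟨j, rfl⟩)
  · have : (1 : Λ) = algebraMap k Λ c⁻¹ * g i := by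
      rw [← hc, ← map_mul, inv_mul_cancel₀ hc0, map_one]
    rw [this]
    exact Ideal.mul_mem_left _ _ (Ideal.subset_span ⟨i, rfl⟩)

variable [GradedAlgebra 𝒜]

theorem RelationsTrivial.span_inf_gradedFilt {g : Fin t → Λ} (h : RelationsTrivial k g)
    {μ : Fin t → Λ} {d : Fin t → ℕ} (hg : ∀ i, g i ∈ 𝒜 (d i))
    (hμ : ∀ i, μ i ∈ ⨆ j, ⨆ (_ : j < d i), 𝒜 j) (m : ℕ) :
    (Ideal.span (Set.range fun i => g i - μ i)).restrictScalars k ⊓ gradedFilt 𝒜 m =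
      ⨆ i : Fin t,
        if d i ≤ m then
          Submodule.map (LinearMap.mulRight k (g i - μ i)) (gradedFilt 𝒜 (m - d i))
        else ⊥ := by
  apply le_antisymm
  · rintro x ⟨hx, hm⟩
    obtain ⟨a, rfl, ha⟩ := h.exists_relMap_eq 𝒜 hg hμ m hx ((mem_gradedFilt_iff 𝒜).1 hm)
    have ha' : ∀ i, ∀ n > (m : ℤ) - d i, intProj 𝒜 n (a i) = 0 := fun i n hn => by
      simpa using congrFun (ha (n + d i) (by omega)) i
    rw [relMap_apply]
    refine Submodule.sum_mem _ fun i _ => Submodule.mem_iSup_of_mem i ?_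
    split_ifs with hi
    · refine ⟨a i, (mem_gradedFilt_iff 𝒜).2 fun n hn => ha' i n (by omega), rfl⟩
    · have hc := isComponents_intProj 𝒜
      rw [hc.sep (a i) fun n => ?_, zero_mul]
      · exact zero_mem _
      · rcases lt_or_ge n 0 with hn | hn
        · exact hc.neg n hn _
        · exact ha' i n (by omega)
  · refine iSup_le fun i => ?_
    split_ifs with hi
    · rintro _ ⟨a, ha, rfl⟩
      refine ⟨Ideal.mul_mem_left _ _ (Ideal.subset_span ⟨i, rfl⟩), ?_⟩
      have ha' := (mem_gradedFilt_iff 𝒜).1 ha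
      refine (mem_gradedFilt_iff 𝒜).2 fun n hn => ?_
      rw [LinearMap.mulRight_apply, intProj_mul_sub 𝒜 _ (hμ i) ha' (by omega),
        intProj_mul_of_mem 𝒜 (hg i), ha' _ (by omega), zero_mul]
    · exact bot_le

theorem RelationsTrivial.gradedGrIdeal_eq {g : Fin t → Λ} (h : RelationsTrivial k g)
    {μ : Fin t → Λ} {d : Fin t → ℕ} (hg : ∀ i, g i ∈ 𝒜 (d i))
    (hμ : ∀ i, μ i ∈ ⨆ j, ⨆ (_ : j < d i), 𝒜 j) :
    gradedGrIdeal 𝒜 (Ideal.span (Set.range fun i => g i - μ i)) =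
      (Ideal.span (Set.range g)).restrictScalars k := by
  have hc := isComponents_intProj 𝒜
  apply le_antisymm
  · refine Submodule.span_le.2 ?_
    rintro _ ⟨x, hx, m, hm, rfl⟩
    obtain ⟨a, rfl, ha⟩ := h.exists_relMap_eq 𝒜 hg hμ m hx ((mem_gradedFilt_iff 𝒜).1 hm)
    rw [← intProj_natCast, intProj_relMap_sub 𝒜 g hμ m a ha m le_rfl, intProj_relMap 𝒜 hg]
    exact (mem_span_range_iff_relMap _ _).2 ⟨_, rfl⟩
  · intro x hx
    obtain ⟨a, rfl⟩ := (mem_span_range_iff_relMap (k := k) _ _).1 hx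
    rw [relMap_apply]
    refine Submodule.sum_mem _ fun i _ => ?_
    obtain ⟨N, hN⟩ := hc.exists_eq_sum (a i)
    rw [hN, Finset.sum_mul]
    refine Submodule.sum_mem _ fun n _ => ?_
    set b := intProj 𝒜 n (a i)
    have hb : ∀ m > (n : ℤ), intProj 𝒜 m b = 0 := fun m hm => hc.orth _ _ _ (by omega)
    refine Submodule.subset_span ⟨b * (g i - μ i),
      Ideal.mul_mem_left _ _ (Ideal.subset_span ⟨i, rfl⟩), n + d i, ?_, ?_⟩
    · refine (mem_gradedFilt_iff 𝒜).2 fun m hm => ?_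
      push_cast at hm
      rw [intProj_mul_sub 𝒜 _ (hμ i) hb (by omega), intProj_mul_of_mem 𝒜 (hg i),
        hb _ (by omega), zero_mul]
    · rw [← intProj_natCast, intProj_mul_sub 𝒜 _ (hμ i) hb (by push_cast; omega),
        intProj_mul_of_mem 𝒜 (hg i), Nat.cast_add, add_sub_cancel_right, hc.same]

theorem RelationsTrivial.isRegularSequence_sub {g : Fin t → Λ} (h : RelationsTrivial k g)
    {μ : Fin t → Λ} {d : Fin t → ℕ} (hg : ∀ i, g i ∈ 𝒜 (d i)) (hd : ∀ i, 0 < d i)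
    (hμ : ∀ i, μ i ∈ ⨆ j, ⨆ (_ : j < d i), 𝒜 j)
    (htop : Ideal.span (Set.range fun i => g i - μ i) ≠ ⊤) :
    IsRegularSequence fun i => g i - μ i := by
  intro i
  refine ⟨fun x hx => ?_, fun htop' => htop (top_le_iff.1 ?_)⟩
  · have hi : i.1 + 1 ≤ t := i.2
    have hrel := (h.castLE 𝒜 hg hd hi).sub 𝒜 (d := fun j => d (j.castLE hi))
      (μ := fun j => μ (j.castLE hi)) (fun j => hg _) (fun j => hμ _)
    have himage : (fun i => g i - μ i) '' {j | j < i} = Set.range fun j : Fin i.1 =>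
        g (j.castSucc.castLE hi) - μ (j.castSucc.castLE hi) := by
      ext y
      constructor
      · rintro ⟨j, hj, rfl⟩
        exact ⟨⟨j.1, hj⟩, rfl⟩
      · rintro ⟨j, rfl⟩
        exact ⟨j.castSucc.castLE hi, j.2, rfl⟩
    rw [himage] at hx ⊢
    exact hrel.mem_of_last_mul_mem hx
  · rw [← htop']
    exact Ideal.span_mono (Set.image_subset_range _ _)

end Main

/-- Let `Λ` be a graded affine `k`-algebra with associated filtration
`{Λ_i}`, `g = {g 1, …, g t}` a complete intersection for `Λ` of homogeneous elements with
`d i = deg (g i)`, `μ 1, …, μ t ∈ Λ` with `deg (μ i) < deg (g i)`, and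
`I_μ = (g 1 − μ 1, …, g t − μ t)`. Then (1) `I_μ ∩ Λ_m = Σ_i Λ_{m - d i}·(g i − μ i)`;
(2) `g 1 − μ 1, …, g t − μ t` is a complete intersection for `Λ` and a regular sequence;
(3) the associated graded ideal of `I_μ` is the ideal generated by `g 1, …, g t`, and in
particular `I_μ ≠ Λ`. -/
theorem statement6 {k : Type u} {Λ : Type v} [Field k] [IsAlgClosed k] [CharZero k]
    [CommRing Λ] [Nontrivial Λ] [Algebra k Λ] [Algebra.FiniteType k Λ]
    (𝒜 : ℕ → Submodule k Λ) [GradedAlgebra 𝒜] (h0 : 𝒜 0 = 1)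
    {t : ℕ} (g : Fin t → Λ) (d : Fin t → ℕ)
    (hhom : ∀ i, g i ∈ 𝒜 (d i))
    (hCI : IsCompleteIntersection k g)
    (μ : Fin t → Λ) (hμ : ∀ i, μ i ∈ ⨆ j, ⨆ (_ : j < d i), 𝒜 j) :
    (∀ m : ℕ,
        (Ideal.span (Set.range fun i => g i - μ i)).restrictScalars k ⊓ gradedFilt 𝒜 m =
          ⨆ i : Fin t,
            if d i ≤ m then
              Submodule.map (LinearMap.mulRight k (g i - μ i)) (gradedFilt 𝒜 (m - d i))
            else ⊥) ∧
      (IsCompleteIntersection k (fun i => g i - μ i) ∧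
        IsRegularSequence (fun i => g i - μ i)) ∧
      (gradedGrIdeal 𝒜 (Ideal.span (Set.range fun i => g i - μ i)) =
          (Ideal.span (Set.range g)).restrictScalars k ∧
        Ideal.span (Set.range fun i => g i - μ i) ≠ ⊤) := by
  have hrel : RelationsTrivial k g := relationsTrivial_of_ker_koszulD_eq_range (hCI.1 0)
  have hd := degree_pos_of_isCompleteIntersection 𝒜 h0 hhom hCI
  have hgr := hrel.gradedGrIdeal_eq 𝒜 hhom hμ
  have htop : Ideal.span (Set.range fun i => g i - μ i) ≠ ⊤ := by
    intro h
    refine hCI.2 ((Ideal.eq_top_iff_one _).2 ?_)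
    suffices (1 : Λ) ∈ gradedGrIdeal 𝒜 (Ideal.span (Set.range fun i => g i - μ i)) by
      rwa [hgr] at this
    have h1 : (1 : Λ) ∈ 𝒜 0 := SetLike.GradedOne.one_mem
    exact Submodule.subset_span ⟨1, by rw [h]; trivial, 0,
      Submodule.mem_iSup_of_mem 0 (Submodule.mem_iSup_of_mem le_rfl h1),
      (DirectSum.decompose_of_mem_same 𝒜 h1).symm⟩
  refine ⟨hrel.span_inf_gradedFilt 𝒜 hhom hμ,
    ⟨⟨fun i => ker_koszulD_sub_eq_range 𝒜 hhom hμ i (hCI.1 i), htop⟩,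
      hrel.isRegularSequence_sub 𝒜 hhom hd hμ htop⟩, hgr, htop⟩

end
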